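/- Let G be a countable MIF group. Then there exists a comeager subset C of L(G) such that for all ℓ₁, ℓ₂ ∈ C, the ℒ-structures G_{ℓ₁} and G_{ℓ₂} are elementarily equivalent (they satisfy the same first-order ℒ-sentences). -/

import Mathlib

open Set Function Pointwise

section Defs

variable {G : Type*} [Group G]

/-- A length function on a group. -/
def IsLengthFun (ℓ : G → ℕ) : Prop :=
  (∀ g : G, ℓ g = 0 ↔ g = 1) ∧ (∀ g : G, ℓ g⁻¹ = ℓ g) ∧ ∀ g h : G, ℓ (g * h) ≤ ℓ g + ℓ h

/-- The space of length functions, topologized as a subspace of `G → ℕ`. -/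
abbrev LengthFun (G : Type*) [Group G] : Type _ := {ℓ : G → ℕ // IsLengthFun ℓ}

/-- Word length with respect to a generating set `X`. -/
noncomputable def wordLength (X : Set G) (g : G) : ℕ :=
  sInf {n : ℕ | ∃ w : List G, w.length = n ∧ (∀ x ∈ w, x ∈ X ∨ x⁻¹ ∈ X) ∧ w.prod = g}

/-- A length function is a word length. -/
def IsWordLength (ℓ : G → ℕ) : Prop :=
  ∃ X : Set G, Subgroup.closure X = ⊤ ∧ ∀ g : G, ℓ g = wordLength X g

/-- Mixed identity free group. -/
def MIF (G : Type*) [Group G] : Prop :=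
  ∀ w : Monoid.Coprod G (FreeGroup Unit), w ≠ 1 →
    ∃ g : G, Monoid.Coprod.lift (MonoidHom.id G) (FreeGroup.lift fun _ => g) w ≠ 1

/-- The length function associated to a weight function `ω`. -/
noncomputable def weightLength (ω : G → ℕ) (g : G) : ℕ :=
  sInf {N : ℕ | ∃ w : List (G × Bool),
    (w.map fun p => ω p.1).sum = N ∧
    (w.map fun p => if p.2 then p.1 else p.1⁻¹).prod = g}

/-- `(ℓ, a)`-consistency of a tuple of distances. -/
def Consistent (ℓ : G → ℕ) {n : ℕ} (a : Fin n → G) (d : Fin n → ℕ) : Prop :=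
  ∀ i j : Fin n, d i ≤ ℓ ((a i)⁻¹ * a j) + d j ∧ ℓ ((a i)⁻¹ * a j) ≤ d i + d j

/-- The bi-Lipschitz preorder on length functions. -/
def Preceq (ℓ₁ ℓ₂ : G → ℕ) : Prop :=
  ∃ C : ℕ, ∀ g : G, g ≠ 1 → ℓ₁ g ≤ C * ℓ₂ g

/-- The conjugacy action of `G` on its space of length functions. -/
def conjLF (g : G) (ℓ : LengthFun G) : LengthFun G :=
  ⟨fun x => ℓ.1 (g⁻¹ * x * g), by
    obtain ⟨h1, h2, h3⟩ := ℓ.2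
    refine ⟨fun x => ?_, fun x => ?_, fun x y => ?_⟩
    · rw [h1]
      constructor
      · intro h
        have := congrArg (fun z => g * z * g⁻¹) h
        simpa [mul_assoc] using this
      · rintro rfl; simp
    · show ℓ.1 (g⁻¹ * x⁻¹ * g) = ℓ.1 (g⁻¹ * x * g)
      have h : g⁻¹ * x⁻¹ * g = (g⁻¹ * x * g)⁻¹ := by group
      rw [h, h2]
    · show ℓ.1 (g⁻¹ * (x * y) * g) ≤ ℓ.1 (g⁻¹ * x * g) + ℓ.1 (g⁻¹ * y * g)
      have h : g⁻¹ * (x * y) * g = (g⁻¹ * x * g) * (g⁻¹ * y * g) := by group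
      rw [h]
      exact h3 _ _⟩

/-- Topological transitivity of the conjugacy action on `LengthFun G`. -/
def ConjTopTransitive (G : Type*) [Group G] : Prop :=
  ∀ U V : Set (LengthFun G), IsOpen U → IsOpen V → U.Nonempty → V.Nonempty →
    ∃ g : G, ((conjLF g '' U) ∩ V).Nonempty

end Defs

/-- The language with one binary function symbol and countably many unary predicates. -/
def lengthLang : FirstOrder.Language where
  Functions := fun n => match n with | 2 => Unit | _ => Empty
  Relations := fun n => match n with | 1 => ℕ | _ => Empty

/-- The `lengthLang`-structure on `G` associated to a length function `ℓ`. -/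
def lengthStructure {G : Type*} [Group G] (ℓ : G → ℕ) : lengthLang.Structure G where
  funMap {n} f x :=
    match n, f, x with
    | 2, _, x => x 0 * x 1
  RelMap {n} r x :=
    match n, r, x with
    | 1, i, x => ℓ (x 0) = i

namespace Monoid.CoprodI.NeWord

variable {ι : Type*} {H : ι → Type*} [∀ i, Group (H i)]

theorem prod_ne_one {i j : ι} (w : NeWord H i j) : w.prod ≠ 1 := by
  classical
  intro h
  have h1 : w.toWord = Word.empty := by
    apply (Word.equiv (M := H)).symm.injective
    change w.toWord.prod = Word.empty.prod
    simpa [NeWord.prod] using h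
  exact w.toList_ne_nil (congrArg Word.toList h1)

end Monoid.CoprodI.NeWord

namespace Monoid.CoprodI

variable {H : Bool → Type*} [∀ i, Group (H i)]

theorem exists_neWord_of_ne_one {ι : Type*} {H : ι → Type*} [∀ i, Group (H i)]
    {u : CoprodI H} (hu : u ≠ 1) : ∃ (i j : ι) (w : NeWord H i j), w.prod = u := by
  classical
  have hne : Word.equiv u ≠ Word.empty := by
    intro h
    apply hu
    rw [← Word.equiv.symm_apply_apply u, h]
    exact Word.prod_empty
  obtain ⟨i, j, w, hw⟩ := NeWord.of_word _ hne
  refine ⟨i, j, w, ?_⟩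
  rw [NeWord.prod, hw]
  exact Word.equiv.symm_apply_apply u

/-- In a free product of two groups, one of which has at least three elements, every nontrivial
normal subgroup contains an element whose reduced word starts and ends in that factor. -/
theorem exists_neWord_mem_of_normal (hH : ∀ x : H true, ∃ h, h ≠ 1 ∧ h ≠ x)
    (N : Subgroup (CoprodI H)) [N.Normal] {u : CoprodI H} (hu : u ≠ 1) (huN : u ∈ N) :
    ∃ w : NeWord H true true, w.prod ∈ N := by
  have key (w : NeWord H true false) (hw : w.prod ∈ N) :
      ∃ w' : NeWord H true true, w'.prod ∈ N := by
    obtain ⟨h, h1, h2⟩ := hH w.head⁻¹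
    have h3 : h * w.head ≠ 1 := fun h4 => h2 (eq_inv_of_mul_eq_one_left h4)
    refine ⟨.append (w.mulHead h h3) Bool.false_ne_true (.singleton h⁻¹ (inv_ne_one.mpr h1)), ?_⟩
    simpa using Subgroup.Normal.conj_mem ‹_› _ hw (of h)
  obtain ⟨i, j, w, rfl⟩ := exists_neWord_of_ne_one hu
  match i, j, w with
  | true, true, w => exact ⟨w, huN⟩
  | true, false, w => exact key w huN
  | false, true, w => exact key w.inv (by simpa using huN)
  | false, false, w =>
    obtain ⟨h, h1, -⟩ := hH 1
    refine ⟨.append (.append (.singleton h h1) Bool.false_ne_true.symm w)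
      Bool.false_ne_true (.singleton h⁻¹ (inv_ne_one.mpr h1)), ?_⟩
    simpa using Subgroup.Normal.conj_mem ‹_› _ huN (of h)

theorem normal_inf_ne_bot (hH : ∀ x : H true, ∃ h, h ≠ 1 ∧ h ≠ x) [Nontrivial (H false)]
    (M N : Subgroup (CoprodI H)) [hMn : M.Normal] [hNn : N.Normal] (hM : M ≠ ⊥) (hN : N ≠ ⊥) :
    M ⊓ N ≠ ⊥ := by
  obtain ⟨u, huM, hu⟩ := M.bot_or_exists_ne_one.resolve_left hM
  obtain ⟨v, hvN, hv⟩ := N.bot_or_exists_ne_one.resolve_left hN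
  obtain ⟨w, hw⟩ := exists_neWord_mem_of_normal hH M hu huM
  obtain ⟨w', hw'⟩ := exists_neWord_mem_of_normal hH N hv hvN
  obtain ⟨a, ha⟩ := exists_ne (1 : H false)
  let q : NeWord H false false :=
    .append (.append (.singleton a ha) Bool.false_ne_true w') Bool.false_ne_true.symm
      (.singleton a⁻¹ (inv_ne_one.mpr ha))
  have hq : q.prod ∈ N := by
    simpa [q] using hNn.conj_mem _ hw' (of a)
  let r : NeWord H true false :=
    .append (.append (.append w Bool.false_ne_true.symm q) Bool.false_ne_true w.inv)
      Bool.false_ne_true.symm q.inv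
  have hr : r.prod = w.prod * q.prod * w.prod⁻¹ * q.prod⁻¹ := by simp [r]
  refine fun h => r.prod_ne_one ((Subgroup.mem_bot).1 (h ▸ ⟨?_, ?_⟩))
  · rw [hr, mul_assoc, mul_assoc, ← mul_assoc q.prod]
    exact M.mul_mem hw (hMn.conj_mem _ (M.inv_mem hw) _)
  · rw [hr]
    exact N.mul_mem (hNn.conj_mem _ hq _) (N.inv_mem hq)

end Monoid.CoprodI


/-- The family of the two factors `G` and `FreeGroup Unit` of the group of words in one variable
with constants in `G`, indexed by `Bool`. -/
def MixedFactors (G : Type) : Bool → Type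
  | false => G
  | true => FreeGroup Unit

instance (G : Type) [Group G] : ∀ b, Group (MixedFactors G b)
  | false => inferInstanceAs (Group G)
  | true => inferInstanceAs (Group (FreeGroup Unit))

/-- The free product `G ∗ ⟨x⟩`, as an indexed free product. -/
abbrev MixedWord (G : Type) [Group G] : Type := Monoid.CoprodI (MixedFactors G)

namespace MixedWord

variable {G : Type} [Group G]

/-- A constant, as a word. -/
def C : G →* MixedWord G := Monoid.CoprodI.of (M := MixedFactors G) (i := false)

/-- The inclusion of the words without constants. -/
def ofFree : FreeGroup Unit →* MixedWord G :=
  Monoid.CoprodI.of (M := MixedFactors G) (i := true)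

/-- The variable, as a word. -/
def X : MixedWord G := ofFree (FreeGroup.of ())

/-- The universal property of `G ∗ ⟨x⟩`. -/
def lift {K : Type*} [Group K] (f : G →* K) (k : K) : MixedWord G →* K :=
  Monoid.CoprodI.lift fun b => match b with
    | false => f
    | true => FreeGroup.lift fun _ => k

@[simp]
theorem lift_C {K : Type*} [Group K] (f : G →* K) (k : K) (g : G) : lift f k (C g) = f g :=
  Monoid.CoprodI.lift_of _ _

@[simp]
theorem lift_X {K : Type*} [Group K] (f : G →* K) (k : K) : lift f k (X : MixedWord G) = k :=
  (Monoid.CoprodI.lift_of _ _).trans (FreeGroup.lift_apply_of)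

theorem hom_ext {K : Type*} [Group K] {f f' : MixedWord G →* K} (hC : ∀ g, f (C g) = f' (C g))
    (hX : f X = f' X) : f = f' := by
  refine Monoid.CoprodI.ext_hom _ _ fun b => ?_
  match b with
  | false => exact MonoidHom.ext hC
  | true => exact FreeGroup.ext_hom (f := f.comp ofFree) (g := f'.comp ofFree) fun _ => hX

theorem C_injective : Injective (C : G →* MixedWord G) :=
  Monoid.CoprodI.of_injective (M := MixedFactors G) false

/-- The comparison with the binary free product. -/
def toCoprod : MixedWord G →* Monoid.Coprod G (FreeGroup Unit) :=
  lift Monoid.Coprod.inl (Monoid.Coprod.inr (FreeGroup.of ()))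

theorem toCoprod_injective : Injective (toCoprod : MixedWord G →* _) := by
  have h : (Monoid.Coprod.lift C ofFree).comp toCoprod = MonoidHom.id (MixedWord G) :=
    hom_ext (by simp [toCoprod])
      (by rw [MonoidHom.comp_apply, toCoprod, lift_X, Monoid.Coprod.lift_apply_inr]; rfl)
  exact LeftInverse.injective (g := Monoid.Coprod.lift C ofFree) fun w => DFunLike.congr_fun h w

/-- The value of a word at an element of `G`. -/
def eval (g : G) : MixedWord G →* G := lift (MonoidHom.id G) g

theorem lift_toCoprod (g : G) (w : MixedWord G) :
    Monoid.Coprod.lift (MonoidHom.id G) (FreeGroup.lift fun _ => g) (toCoprod w) = eval g w := by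
  have h : (Monoid.Coprod.lift (MonoidHom.id G) (FreeGroup.lift fun _ => g)).comp toCoprod
      = eval g := hom_ext (by simp [toCoprod, eval]) (by simp [toCoprod, eval])
  exact DFunLike.congr_fun h w

/-- The copy `g` of an element of `G` if `b = false`, and its copy `x g x⁻¹` if `b = true`. -/
def letter (g : G) (b : Bool) : MixedWord G :=
  bif b then X * C g * X⁻¹ else C g

/-- The action of `G` on the first of two copies of itself by left translations. -/
def sheetHom : G →* Equiv.Perm (G × Bool) where
  toFun g :=
    { toFun p := (bif p.2 then p.1 else g * p.1, p.2)
      invFun p := (bif p.2 then p.1 else g⁻¹ * p.1, p.2)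
      left_inv := by rintro ⟨h, _ | _⟩ <;> simp
      right_inv := by rintro ⟨h, _ | _⟩ <;> simp }
  map_one' := by ext ⟨h, _ | _⟩ <;> simp
  map_mul' g g' := by ext ⟨h, _ | _⟩ <;> simp [mul_assoc]

/-- The exchange of two copies of `G`. -/
def sheetSwap : Equiv.Perm (G × Bool) where
  toFun p := (p.1, !p.2)
  invFun p := (p.1, !p.2)
  left_inv := by rintro ⟨h, _ | _⟩ <;> simp
  right_inv := by rintro ⟨h, _ | _⟩ <;> simp

theorem lift_letter_apply (g h : G) (b c : Bool) :
    lift sheetHom sheetSwap (letter g b) (h, c) = ((if b = c then g else 1) * h, c) := by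
  cases b <;> cases c <;>
    simp [letter, sheetHom, sheetSwap, Equiv.Perm.inv_def]

theorem lift_prod_letter_apply (L : List (G × Bool)) (h : G) (c : Bool) :
    lift sheetHom sheetSwap (L.map fun p => letter p.1 p.2).prod (h, c) =
      ((L.map fun p => if p.2 = c then p.1 else 1).prod * h, c) := by
  induction L with
  | nil => simp
  | cons p L ih => simp [lift_letter_apply, ih, mul_assoc]

/-- The two copies `G` and `x G x⁻¹` generate their free product; here we record that one can
project to either of them. -/
theorem eq_prod_of_letter_eq_prod {g : G} {c : Bool} {L : List (G × Bool)}
    (h : letter g c = (L.map fun p => letter p.1 p.2).prod) :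
    g = (L.map fun p => if p.2 = c then p.1 else 1).prod := by
  have h1 := lift_letter_apply g 1 c c
  rw [h, lift_prod_letter_apply] at h1
  simpa using h1.symm

end MixedWord

theorem MIF.nontrivial {G : Type} [Group G] (hG : MIF G) : Nontrivial G := by
  obtain ⟨g, hg⟩ := hG (MixedWord.toCoprod MixedWord.X) fun h => by
    have h1 := congrArg (Monoid.Coprod.lift (1 : G →* FreeGroup Unit) (MonoidHom.id _)) h
    simp [MixedWord.toCoprod] at h1
  exact ⟨⟨g, 1, fun h => hg (by simp [MixedWord.toCoprod, h])⟩⟩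

theorem MIF.exists_eval_ne_one {G : Type} [Group G] (hG : MIF G) {S : Set (MixedWord G)}
    (hS : S.Finite) : ∃ g : G, ∀ w ∈ S, w ≠ 1 → MixedWord.eval g w ≠ 1 := by
  have := hG.nontrivial
  have hfree : ∀ x : MixedFactors G true, ∃ h, h ≠ 1 ∧ h ≠ x := by
    intro (x : FreeGroup Unit)
    have : Infinite (FreeGroup Unit) := inferInstance
    obtain ⟨h, hh⟩ := Set.Finite.exists_notMem (Set.toFinite {1, x})
    exact ⟨h, fun h1 => hh (Or.inl h1), fun h1 => hh (Or.inr h1)⟩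
  have : Nontrivial (MixedFactors G false) := ‹Nontrivial G›
  have hnt : Nontrivial (MixedWord G) := MixedWord.C_injective.nontrivial
  obtain ⟨N, hN, hN1, hNS⟩ : ∃ N : Subgroup (MixedWord G), N.Normal ∧ N ≠ ⊥ ∧
      ∀ w ∈ S, w ≠ 1 → N ≤ Subgroup.normalClosure {w} := by
    induction S, hS using Set.Finite.induction_on with
    | empty => exact ⟨⊤, inferInstance, top_ne_bot, by simp⟩
    | @insert w S _ _ ih =>
      obtain ⟨N, hN, hN1, hNS⟩ := ih
      by_cases hw : w = 1
      · refine ⟨N, hN, hN1, ?_⟩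
        rintro v (rfl | hv) hv1
        exacts [absurd hw hv1, hNS v hv hv1]
      refine ⟨N ⊓ Subgroup.normalClosure {w}, inferInstance,
        Monoid.CoprodI.normal_inf_ne_bot hfree _ _ hN1 ?_, ?_⟩
      · intro h
        exact hw (Subgroup.mem_bot.1 (h ▸ Subgroup.subset_normalClosure rfl))
      · rintro v (rfl | hv) hv1
        exacts [inf_le_right, inf_le_left.trans (hNS v hv hv1)]
  obtain ⟨u, huN, hu⟩ := N.bot_or_exists_ne_one.resolve_left hN1
  obtain ⟨g, hg⟩ := hG (MixedWord.toCoprod u)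
    ((map_ne_one_iff _ MixedWord.toCoprod_injective).2 hu)
  rw [MixedWord.lift_toCoprod] at hg
  refine ⟨g, fun w hw hw1 hgw => hg ?_⟩
  have h : Subgroup.normalClosure {w} ≤ (MixedWord.eval g).ker :=
    Subgroup.normalClosure_le_normal (by simpa using hgw)
  exact h (hNS w hw hw1 huN)

/-- The length of an element with respect to generators `e i` of cost `c i`, where all lengths are
truncated at `M`. -/
noncomputable def cappedLength {G α : Type*} [Group G] (e : α → G) (c : α → ℕ) (M : ℕ) (g : G) :
    ℕ :=
  sInf {N : ℕ | N = M ∨ ∃ L : List α, (L.map c).sum = N ∧ (L.map e).prod = g}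

section CappedLength

variable {G α : Type*} [Group G] {e : α → G} {c : α → ℕ} {M : ℕ}

theorem cappedLength_le (g : G) : cappedLength e c M g ≤ M := Nat.sInf_le (Or.inl rfl)

theorem cappedLength_prod_le (L : List α) :
    cappedLength e c M (L.map e).prod ≤ (L.map c).sum :=
  Nat.sInf_le (Or.inr ⟨L, rfl, rfl⟩)

theorem cappedLength_spec (g : G) : cappedLength e c M g = M ∨
    ∃ L : List α, (L.map c).sum = cappedLength e c M g ∧ (L.map e).prod = g :=
  Nat.sInf_mem (s := {N : ℕ | N = M ∨ ∃ L : List α, (L.map c).sum = N ∧ (L.map e).prod = g})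
    ⟨M, Or.inl rfl⟩

theorem isLengthFun_cappedLength (hM : 0 < M) (hc : ∀ i, 0 < c i) (inv : α → α)
    (he : ∀ i, e (inv i) = (e i)⁻¹) (hci : ∀ i, c (inv i) = c i) :
    IsLengthFun (cappedLength e c M) := by
  have hinv (g : G) : cappedLength e c M g⁻¹ ≤ cappedLength e c M g := by
    obtain h | ⟨L, hL, rfl⟩ := cappedLength_spec (e := e) (c := c) (M := M) g
    · rw [h]; exact cappedLength_le _
    · have h1 : (((L.map inv).reverse).map e).prod = ((L.map e).prod)⁻¹ := by
        rw [List.prod_inv_reverse, List.map_reverse, List.map_map, List.map_map]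
        congr 3
        exact funext he
      have h2 : (((L.map inv).reverse).map c).sum = (L.map c).sum := by
        rw [List.map_reverse, List.sum_reverse, List.map_map]
        congr 2
        exact funext hci
      rw [← h1, ← hL, ← h2]
      exact cappedLength_prod_le _
  refine ⟨fun g => ⟨fun h => ?_, ?_⟩, fun g => ?_, fun g h => ?_⟩
  · obtain h' | ⟨L, hL, rfl⟩ := cappedLength_spec (e := e) (c := c) (M := M) g
    · omega
    · rw [h] at hL
      cases L with
      | nil => simp
      | cons i L =>
        have := hc i
        simp at hL
        omega
  · rintro rfl
    simpa using cappedLength_prod_le (e := e) (c := c) (M := M) []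
  · exact le_antisymm (hinv g) (by simpa using hinv g⁻¹)
  · obtain h1 | ⟨L, hL, rfl⟩ := cappedLength_spec (e := e) (c := c) (M := M) g
    · have := cappedLength_le (e := e) (c := c) (M := M) (g * h)
      omega
    obtain h1 | ⟨L', hL', rfl⟩ := cappedLength_spec (e := e) (c := c) (M := M) h
    · have := cappedLength_le (e := e) (c := c) (M := M) ((L.map e).prod * h)
      omega
    rw [← hL, ← hL']
    simpa using cappedLength_prod_le (e := e) (c := c) (M := M) (L ++ L')

theorem le_cappedLength (hc : ∀ i, 0 < c i) {k : ℕ} (hk : k ≤ M) {g : G}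
    (h : ∀ L : List α, L.length ≤ M → (L.map e).prod = g → k ≤ (L.map c).sum) :
    k ≤ cappedLength e c M g := by
  obtain h1 | ⟨L, hL, hg⟩ := cappedLength_spec (e := e) (c := c) (M := M) g
  · omega
  · rw [← hL]
    refine h L ?_ hg
    have h1 : L.length ≤ (L.map c).sum := by
      simpa using List.length_le_sum_of_one_le (L.map c) (by simpa [Nat.one_le_iff_ne_zero, Nat.pos_iff_ne_zero] using fun i _ => (hc i).ne')
    have := cappedLength_le (e := e) (c := c) (M := M) g
    omega

end CappedLength

/-- Two length functions on an MIF group can be amalgamated: on a given finite set, the first one is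
realized as is and the second one after conjugation by some element. -/
theorem MIF.exists_lengthFun_amalgam {G : Type} [Group G] (hG : MIF G) (ℓ : Bool → LengthFun G)
    {F : Set G} (hF : F.Finite) :
    ∃ (t : G) (m : LengthFun G), ∀ a ∈ F,
      m.1 a = (ℓ false).1 a ∧ m.1 (t * a * t⁻¹) = (ℓ true).1 a := by
  let A : Set G := (F ∪ F⁻¹) \ {1}
  have hA : A.Finite := (hF.union hF.inv).sdiff
  have hAinv (a : A) : (a : G)⁻¹ ∈ A := by
    obtain ⟨a, ha, ha1⟩ := a
    refine ⟨?_, by simpa using ha1⟩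
    simpa [or_comm] using ha
  have : Finite A := hA
  let c : A × Bool → ℕ := fun p => (ℓ p.2).1 p.1
  have hc (p : A × Bool) : 0 < c p :=
    Nat.pos_of_ne_zero fun h => p.1.2.2 (((ℓ p.2).2.1 _).1 h)
  obtain ⟨M, hM⟩ := (Set.finite_range c).bddAbove
  replace hM (p : A × Bool) : c p ≤ M + 1 := (hM ⟨p, rfl⟩).trans M.le_succ
  let E : A × Bool → MixedWord G := fun p => MixedWord.letter p.1 p.2
  obtain ⟨t, ht⟩ := hG.exists_eval_ne_one
    (S := (fun q : (A × Bool) × List (A × Bool) => (E q.1)⁻¹ * (q.2.map E).prod) ''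
      (Set.univ ×ˢ {L | L.length ≤ M + 1}))
    ((Set.finite_univ.prod (List.finite_length_le _ _)).image _)
  let e : A × Bool → G := fun p => MixedWord.eval t (E p)
  have hm : IsLengthFun (cappedLength e c (M + 1)) := by
    refine isLengthFun_cappedLength M.succ_pos hc (fun p => (⟨_, hAinv p.1⟩, p.2)) ?_ ?_
    · rintro ⟨a, _ | _⟩ <;> simp [e, E, MixedWord.letter, mul_assoc]
    · exact fun p => (ℓ p.2).2.2.1 _
  have key (p : A × Bool) : cappedLength e c (M + 1) (e p) = c p := by
    refine le_antisymm (by simpa using cappedLength_prod_le (e := e) (c := c) (M := M + 1) [p])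
      (le_cappedLength hc (hM p) fun L hL hLp => ?_)
    have h1 : E p = (L.map E).prod := by
      by_contra hne
      refine ht _ ⟨(p, L), ⟨trivial, hL⟩, rfl⟩ (fun h => hne (inv_mul_eq_one.1 h)) ?_
      rw [map_mul, map_inv, inv_mul_eq_one, map_list_prod, List.map_map]
      exact hLp.symm
    have h2 := MixedWord.eq_prod_of_letter_eq_prod (L := L.map fun q => ((q.1 : G), q.2))
      (h1.trans (by rw [List.map_map]; rfl))
    have h3 : ∀ L : List (A × Bool), (ℓ p.2).1
        ((L.map fun q => ((q.1 : G), q.2)).map fun q => if q.2 = p.2 then q.1 else 1).prod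
          ≤ (L.map c).sum := by
      have h0 := ((ℓ p.2).2.1 1).2 rfl
      intro L
      induction L with
      | nil => simp [h0]
      | cons q L ih =>
        simp only [List.map_cons, List.prod_cons, List.sum_cons]
        refine ((ℓ p.2).2.2.2 _ _).trans (Nat.add_le_add ?_ ih)
        split_ifs with hq
        · simp only [c, hq, le_refl]
        · simp [h0]
    exact (congrArg (ℓ p.2).1 h2).trans_le (h3 L)
  refine ⟨t, ⟨_, hm⟩, fun a ha => ?_⟩
  by_cases ha1 : a = 1
  · have h0 := (hm.1 1).2 rfl
    simp [ha1, h0, ((ℓ false).2.1 1).2 rfl, ((ℓ true).2.1 1).2 rfl]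
  · have haA : a ∈ A := ⟨Or.inl ha, ha1⟩
    have h1 := key (⟨a, haA⟩, false)
    have h2 := key (⟨a, haA⟩, true)
    simp only [e, E, c, MixedWord.letter, MixedWord.eval, cond_true, cond_false, map_mul, map_inv,
      MixedWord.lift_C, MixedWord.lift_X, MonoidHom.id_apply] at h1 h2
    exact ⟨h1, h2⟩

section Conjugation

variable {G : Type} [Group G]

theorem continuous_conjLF (g : G) : Continuous (conjLF g) :=
  continuous_induced_rng.2
    (continuous_pi fun x => (continuous_apply (g⁻¹ * x * g)).comp continuous_subtype_val)

/-- Conjugation by `g`, as a homeomorphism of the space of length functions. -/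
def conjHomeomorph (g : G) : LengthFun G ≃ₜ LengthFun G where
  toFun := conjLF g
  invFun := conjLF g⁻¹
  left_inv ℓ := Subtype.ext (funext fun x => congrArg ℓ.1 (by group))
  right_inv ℓ := Subtype.ext (funext fun x => congrArg ℓ.1 (by group))
  continuous_toFun := continuous_conjLF g
  continuous_invFun := continuous_conjLF g⁻¹

theorem isOpen_setOf_apply_eq (g : G) (k : ℕ) : IsOpen {ℓ : LengthFun G | ℓ.1 g = k} := by
  have h : Continuous fun ℓ : LengthFun G => ℓ.1 g :=
    (continuous_apply g).comp continuous_subtype_val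
  exact (isOpen_discrete ({k} : Set ℕ)).preimage h

theorem exists_finite_of_isOpen {U : Set (LengthFun G)} (hU : IsOpen U) {ℓ : LengthFun G}
    (hℓ : ℓ ∈ U) : ∃ F : Set G, F.Finite ∧ ∀ m : LengthFun G, (∀ a ∈ F, m.1 a = ℓ.1 a) → m ∈ U := by
  obtain ⟨V, hV, rfl⟩ := isOpen_induced_iff.1 hU
  obtain ⟨I, u, hu, hI⟩ := isOpen_pi_iff.1 hV ℓ.1 hℓ
  exact ⟨I, I.finite_toSet, fun m hm => hI fun a ha => by rw [hm a ha]; exact (hu a ha).2⟩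

theorem MIF.conjTopTransitive (hG : MIF G) : ConjTopTransitive G := by
  rintro U V hU hV ⟨ℓ₁, h₁⟩ ⟨ℓ₂, h₂⟩
  obtain ⟨F₁, hF₁, hU'⟩ := exists_finite_of_isOpen hU h₁
  obtain ⟨F₂, hF₂, hV'⟩ := exists_finite_of_isOpen hV h₂
  obtain ⟨t, m, hm⟩ := hG.exists_lengthFun_amalgam (fun b => bif b then ℓ₂ else ℓ₁)
    (hF₁.union hF₂)
  refine ⟨t⁻¹, _, ⟨m, hU' m fun a ha => (hm a (Or.inl ha)).1, rfl⟩, hV' _ fun a ha => ?_⟩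
  simpa [conjLF] using (hm a (Or.inr ha)).2

/-- The topological zero-one law for the conjugation action on the space of length functions. -/
theorem ConjTopTransitive.mem_residual_or_compl_mem_residual [Countable G]
    (hG : ConjTopTransitive G) {B : Set (LengthFun G)} (hB : BaireMeasurableSet B)
    (hinv : ∀ g ℓ, conjLF g ℓ ∈ B ↔ ℓ ∈ B) :
    B ∈ residual (LengthFun G) ∨ Bᶜ ∈ residual (LengthFun G) := by
  obtain ⟨U, hU, hBU⟩ := hB.residualEq_isOpen
  rw [Filter.eventuallyEq_set] at hBU
  obtain rfl | hne := U.eq_empty_or_nonempty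
  · right
    filter_upwards [hBU] with ℓ hℓ using fun h => hℓ.1 h
  left
  have h1 : ∀ᶠ ℓ in residual (LengthFun G), ∀ g : G, conjLF g ℓ ∈ B ↔ conjLF g ℓ ∈ U := by
    rw [eventually_countable_forall]
    exact fun g => (tendsto_residual_of_isOpenMap (conjHomeomorph g).continuous
      (conjHomeomorph g).isOpenMap).eventually hBU
  have h2 : (⋃ g : G, conjLF g ⁻¹' U) ∈ residual (LengthFun G) := by
    refine residual_of_dense_open (isOpen_iUnion fun g => hU.preimage (continuous_conjLF g))
      (dense_iff_inter_open.2 fun V hV hVne => ?_)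
    obtain ⟨g, -, ⟨ℓ, hℓ, rfl⟩, hℓU⟩ := hG V U hV hU hVne hne
    exact ⟨ℓ, hℓ, Set.mem_iUnion.2 ⟨g, hℓU⟩⟩
  filter_upwards [h1, h2] with ℓ hℓ hℓU
  obtain ⟨g, hg⟩ := Set.mem_iUnion.1 hℓU
  exact (hinv g ℓ).1 ((hℓ g).2 hg)

end Conjugation

section Definability

open FirstOrder Language

instance : Countable lengthLang.Symbols := by
  have h1 : ∀ n, Countable (lengthLang.Functions n)
    | 0 | 1 | _ + 3 => inferInstanceAs (Countable Empty)
    | 2 => inferInstanceAs (Countable Unit)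
  have h2 : ∀ n, Countable (lengthLang.Relations n)
    | 0 | _ + 2 => inferInstanceAs (Countable Empty)
    | 1 => inferInstanceAs (Countable ℕ)
  exact inferInstanceAs (Countable (_ ⊕ _))

variable {G : Type} [Group G]

theorem realize_term_lengthStructure {α : Type*} (t : lengthLang.Term α) (v : α → G)
    (ℓ₁ ℓ₂ : G → ℕ) :
    @Term.realize lengthLang G (lengthStructure ℓ₁) α v t =
      @Term.realize lengthLang G (lengthStructure ℓ₂) α v t := by
  induction t with
  | var i => rfl
  | @func n f ts ih =>
    match n, f with
    | 2, _ => exact congrArg₂ (· * ·) (ih 0) (ih 1)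

theorem baireMeasurableSet_realize [Countable G] {α : Type*} {n : ℕ}
    (φ : lengthLang.BoundedFormula α n) (v : α → G) (xs : Fin n → G) :
    BaireMeasurableSet {ℓ : LengthFun G |
      @BoundedFormula.Realize lengthLang G (lengthStructure ℓ.1) α n φ v xs} := by
  induction φ with
  | falsum => exact isOpen_empty.baireMeasurableSet
  | equal t₁ t₂ =>
    refine IsOpen.baireMeasurableSet ?_
    have h (ℓ : LengthFun G) : @BoundedFormula.Realize lengthLang G (lengthStructure ℓ.1) α _
        (.equal t₁ t₂) v xs ↔
        @BoundedFormula.Realize lengthLang G (lengthStructure 0) α _ (.equal t₁ t₂) v xs :=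
      Iff.of_eq (congrArg₂ Eq (realize_term_lengthStructure _ _ _ _)
        (realize_term_lengthStructure _ _ _ _))
    simp only [h]
    exact isOpen_const
  | @rel n l R ts =>
    match l, R with
    | 1, i =>
      have h (ℓ : LengthFun G) : @BoundedFormula.Realize lengthLang G (lengthStructure ℓ.1) α _
          (.rel (l := 1) i ts) v xs ↔ ℓ.1 (@Term.realize lengthLang G (lengthStructure 0) _
            (Sum.elim v xs) (ts 0)) = (i : ℕ) := by
        rw [realize_term_lengthStructure _ _ 0 ℓ.1]
        rfl
      simp only [h]
      exact (isOpen_setOf_apply_eq _ _).baireMeasurableSet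
  | imp φ ψ ihφ ihψ =>
    have := (ihφ xs).compl.union (ihψ xs)
    refine (congrArg BaireMeasurableSet (Set.ext fun ℓ => ?_)).mp this
    exact imp_iff_not_or.symm
  | all φ ih =>
    have := BaireMeasurableSet.iInter fun x : G => ih (Fin.snoc xs x)
    refine (congrArg BaireMeasurableSet (Set.ext fun ℓ => ?_)).mp this
    exact Set.mem_iInter

theorem realize_conjLF_iff (g : G) (ℓ : LengthFun G) (σ : lengthLang.Sentence) :
    @Sentence.Realize lengthLang G (lengthStructure (conjLF g ℓ).1) σ ↔
      @Sentence.Realize lengthLang G (lengthStructure ℓ.1) σ := by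
  let e : @Language.Equiv lengthLang G G (lengthStructure (conjLF g ℓ).1) (lengthStructure ℓ.1) :=
    @Language.Equiv.mk lengthLang G G (lengthStructure (conjLF g ℓ).1) (lengthStructure ℓ.1)
      (MulAut.conj g⁻¹).toEquiv
      (fun {n} f x => match n, f, x with
        | 2, _, x => map_mul (MulAut.conj g⁻¹) (x 0) (x 1))
      (fun {n} r x => match n, r, x with
        | 1, i, x => by
          change ℓ.1 (g⁻¹ * x 0 * g⁻¹⁻¹) = _ ↔ ℓ.1 (g⁻¹ * x 0 * g) = _
          rw [inv_inv])
  exact @StrongHomClass.realize_sentence lengthLang G G (lengthStructure (conjLF g ℓ).1)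
    (lengthStructure ℓ.1) _ _ _ e σ

end Definability

theorem stmt6 (G : Type) [Group G] [Countable G] (hG : MIF G) :
    ∃ C ∈ residual (LengthFun G), ∀ ℓ₁ ∈ C, ∀ ℓ₂ ∈ C,
      ∀ σ : lengthLang.Sentence,
        (@FirstOrder.Language.Sentence.Realize lengthLang G (lengthStructure (ℓ₁ : LengthFun G).1) σ ↔
          @FirstOrder.Language.Sentence.Realize lengthLang G (lengthStructure (ℓ₂ : LengthFun G).1) σ) := by
  let B (σ : lengthLang.Sentence) : Set (LengthFun G) :=
    {ℓ | @FirstOrder.Language.Sentence.Realize lengthLang G (lengthStructure ℓ.1) σ}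
  have h (σ : lengthLang.Sentence) : ∃ D ∈ residual (LengthFun G), D = B σ ∨ D = (B σ)ᶜ := by
    obtain h | h := hG.conjTopTransitive.mem_residual_or_compl_mem_residual
      (baireMeasurableSet_realize σ default default) (fun g ℓ => realize_conjLF_iff g ℓ σ)
    exacts [⟨_, h, Or.inl rfl⟩, ⟨_, h, Or.inr rfl⟩]
  choose D hD hDB using h
  have : Countable lengthLang.Sentence := inferInstanceAs (Countable (lengthLang.Formula Empty))
  refine ⟨⋂ σ, D σ, countable_iInter_mem.2 hD, fun ℓ₁ h₁ ℓ₂ h₂ σ => ?_⟩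
  have h₁' := Set.mem_iInter.1 h₁ σ
  have h₂' := Set.mem_iInter.1 h₂ σ
  obtain h | h := hDB σ <;> rw [h] at h₁' h₂'
  exacts [iff_of_true h₁' h₂', iff_of_false h₁' h₂']
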